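/- Let n ∈ ℕ, T > 0, I = [−T,T]. Let P, Q, R, P̃, Q̃ ∈ ℝ[X] with deg P ≤ n, deg Q ≤ n, P = P̃·R, Q = Q̃·R and R(−X) = R(X); define L = φ*P(D) + Q(D), Ł = φ*P̃(D) − Q̃(−D), and S(X) := (P̃(−X)P̃(X) − Q̃(−X)Q̃(X))·R(X). Let real numbers α_{kj}, β_{kj} (k = 1,…,n, j = 0,…,n−1) be given and define the boundary functionals B_k u := ∑_{j=0}^{n−1} (α_{kj} u^{(j)}(−T) + β_{kj} u^{(j)}(T)). Let h : I → ℝ be continuous and let G : I × I → ℝ be such that the function v(t) := ∫_{−T}^{T} G(t,s) h(s) ds is smooth on I and satisfies (S(D)v)(t) = h(t) for all t ∈ I, B_k(Łv) = 0 and B_k v = 0 for k = 1,…,n. Then the function u := Łv satisfies (Lu)(t) = h(t) for all t ∈ I and B_k u = 0 for k = 1,…,n. -/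

import Mathlib

open Polynomial Finset intervalIntegral

section Reflection

variable {K A : Type*} [CommRing K] [Ring A] [Algebra K A] {D φ : A}

theorem aeval_mul_of_anticommute (hDφ : D * φ = φ * -D) (p : K[X]) :
    aeval D p * φ = φ * aeval D (p.comp (-X)) := by
  induction p using Polynomial.induction_on' with
  | add p q hp hq => simp only [map_add, add_comp, add_mul, mul_add, hp, hq]
  | monomial n a =>
    have hpow : D ^ n * φ = φ * (-D) ^ n :=
      (SemiconjBy.pow_right (a := φ) (x := -D) (y := D) hDφ.symm n).symm
    simp only [aeval_comp, map_neg, aeval_X, aeval_monomial, mul_assoc, hpow]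
    rw [← mul_assoc, Algebra.commutes, mul_assoc]

/-- If `φ` is an involution anticommuting with `D` and `R` is even, then
`(φ P(D) + Q(D)) (φ P̃(D) − Q̃(−D)) = S(D)` for `P = P̃ R`, `Q = Q̃ R` and
`S = (P̃(−X) P̃ − Q̃(−X) Q̃) R`. -/
theorem aeval_add_mul_aeval_sub_of_anticommute (hDφ : D * φ = φ * -D) (hφ : φ * φ = 1)
    {R : K[X]} (p q : K[X]) (hR : R.comp (-X) = R) :
    (aeval D (q * R) + φ * aeval D (p * R)) * (φ * aeval D p - aeval D (q.comp (-X))) =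
      aeval D ((p.comp (-X) * p - q.comp (-X) * q) * R) := by
  have hcomm (r s : K[X]) :
      aeval D r * (φ * aeval D s) = φ * aeval D (r.comp (-X) * s) := by
    rw [← mul_assoc, aeval_mul_of_anticommute hDφ, map_mul, mul_assoc]
  rw [add_mul, mul_sub, mul_sub, hcomm, mul_assoc, mul_assoc, hcomm, ← mul_assoc φ φ,
    hφ, one_mul, ← map_mul, ← map_mul, mul_comp, mul_comp, hR,
    show q.comp (-X) * R * p = p * R * q.comp (-X) by ring,
    show (p.comp (-X) * p - q.comp (-X) * q) * R =
      p.comp (-X) * R * p - q * R * q.comp (-X) by ring, map_sub]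
  abel

end Reflection

/-- The space of smooth functions `ℝ → ℝ`. -/
def smoothFunctions : Submodule ℝ (ℝ → ℝ) where
  carrier := {f | ContDiff ℝ (⊤ : ℕ∞) f}
  add_mem' hf hg := by
    simp only [Set.mem_ofPred_eq] at hf hg ⊢
    exact hf.add hg
  zero_mem' := by
    simp only [Set.mem_ofPred_eq]
    exact contDiff_const
  smul_mem' c _ hf := by
    simp only [Set.mem_ofPred_eq] at hf ⊢
    exact hf.const_smul c

namespace smoothFunctions

theorem contDiff (f : smoothFunctions) : ContDiff ℝ (⊤ : ℕ∞) (f : ℝ → ℝ) := f.2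

theorem differentiable (f : smoothFunctions) : Differentiable ℝ (f : ℝ → ℝ) :=
  (contDiff f).differentiable (by simp)

/-- Differentiation, as an endomorphism of the space of smooth functions. -/
noncomputable def derivation : Module.End ℝ smoothFunctions where
  toFun f := ⟨deriv f, (contDiff_infty_iff_deriv.1 (contDiff f)).2⟩
  map_add' f g := by
    ext t
    exact deriv_add (differentiable f t) (differentiable g t)
  map_smul' c f := by
    ext t
    exact deriv_const_mul c (differentiable f t)

/-- The reflection `u ↦ u(-·)`, as an endomorphism of the space of smooth functions. -/
def reflection : Module.End ℝ smoothFunctions where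
  toFun f := ⟨fun t => (f : ℝ → ℝ) (-t), (contDiff f).comp contDiff_neg⟩
  map_add' _ _ := rfl
  map_smul' _ _ := rfl

theorem reflection_apply (f : smoothFunctions) (t : ℝ) :
    (reflection f : ℝ → ℝ) t = (f : ℝ → ℝ) (-t) := rfl

theorem coe_derivation_pow (k : ℕ) (f : smoothFunctions) :
    ((derivation ^ k) f : ℝ → ℝ) = iteratedDeriv k f := by
  induction k with
  | zero => simp
  | succ k ih =>
    rw [pow_succ', Module.End.mul_apply, iteratedDeriv_succ, ← ih]
    rfl

theorem aeval_derivation_apply (p : ℝ[X]) (f : smoothFunctions) (t : ℝ) :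
    (aeval derivation p f : ℝ → ℝ) t =
      ∑ k ∈ Finset.range (p.natDegree + 1), p.coeff k * iteratedDeriv k f t := by
  simp [aeval_eq_sum_range, LinearMap.sum_apply, Finset.sum_apply, coe_derivation_pow]

theorem aeval_comp_neg_X_derivation_apply (p : ℝ[X]) (f : smoothFunctions) (t : ℝ) :
    (aeval derivation (p.comp (-X)) f : ℝ → ℝ) t =
      ∑ k ∈ Finset.range (p.natDegree + 1), (-1 : ℝ) ^ k * p.coeff k * iteratedDeriv k f t := by
  have hdeg : (p.comp (-X)).natDegree = p.natDegree := by simp [natDegree_comp]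
  rw [aeval_derivation_apply, hdeg]
  refine Finset.sum_congr rfl fun k _ => ?_
  rw [show (-X : ℝ[X]) = C (-1) * X by simp, comp_C_mul_X_coeff, mul_comm (p.coeff k)]

theorem reflection_mul_reflection : reflection * reflection = 1 := by
  ext f t
  simp [reflection_apply]

theorem derivation_mul_reflection :
    derivation * reflection = reflection * -derivation := by
  ext f t
  exact deriv_comp_neg (f : ℝ → ℝ) t

end smoothFunctions

/-- Reduction of a boundary value problem for the operator with
reflection `L = φ*P(D) + Q(D)` to one for `S(D)` via `Ł = φ*P̃(D) − Q̃(−D)`: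
if `v(t) = ∫_{−T}^{T} G(t,s)h(s) ds` is smooth, solves `S(D)v = h` on `I = [−T,T]`
and satisfies `B_k(Łv) = 0`, `B_k v = 0` for `k = 1,…,n`, then `u := Łv` solves
`Lu = h` on `I` with `B_k u = 0` for `k = 1,…,n`. -/
theorem stmt_3 (n : ℕ) (T : ℝ) (hT : 0 < T)
    (P Q R Pt Qt : Polynomial ℝ)
    (hPdeg : P.natDegree ≤ n) (hQdeg : Q.natDegree ≤ n)
    (hP : P = Pt * R) (hQ : Q = Qt * R)
    (hR : R.comp (-Polynomial.X) = R)
    (L Lhat : (ℝ → ℝ) → (ℝ → ℝ))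
    (hL : ∀ (u : ℝ → ℝ) (t : ℝ), L u t =
      (∑ k ∈ Finset.range (Q.natDegree + 1), Q.coeff k * iteratedDeriv k u t)
        + ∑ k ∈ Finset.range (P.natDegree + 1), P.coeff k * iteratedDeriv k u (-t))
    (hLhat : ∀ (u : ℝ → ℝ) (t : ℝ), Lhat u t =
      (∑ k ∈ Finset.range (Pt.natDegree + 1), Pt.coeff k * iteratedDeriv k u (-t))
        - ∑ k ∈ Finset.range (Qt.natDegree + 1), (-1 : ℝ) ^ k * Qt.coeff k * iteratedDeriv k u t)
    (S : Polynomial ℝ)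
    (hS : S = (Pt.comp (-Polynomial.X) * Pt - Qt.comp (-Polynomial.X) * Qt) * R)
    (α β : ℕ → ℕ → ℝ)
    (Bf : (ℝ → ℝ) → ℕ → ℝ)
    (hB : ∀ (u : ℝ → ℝ) (k : ℕ), Bf u k =
      ∑ j ∈ Finset.range n, (α k j * iteratedDeriv j u (-T) + β k j * iteratedDeriv j u T))
    (h : ℝ → ℝ) (hh : ContinuousOn h (Set.Icc (-T) T))
    (Grn : ℝ → ℝ → ℝ)
    (v : ℝ → ℝ) (hv : ∀ t : ℝ, v t = ∫ s in (-T)..T, Grn t s * h s)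
    (hvsmooth : ContDiff ℝ (⊤ : ℕ∞) v)
    (hvS : ∀ t ∈ Set.Icc (-T) T,
      (∑ k ∈ Finset.range (S.natDegree + 1), S.coeff k * iteratedDeriv k v t) = h t)
    (hBLhatv : ∀ k ∈ Finset.Icc 1 n, Bf (Lhat v) k = 0)
    (hBv : ∀ k ∈ Finset.Icc 1 n, Bf v k = 0) :
    (∀ t ∈ Set.Icc (-T) T, L (Lhat v) t = h t) ∧
    (∀ k ∈ Finset.Icc 1 n, Bf (Lhat v) k = 0) := by
  refine ⟨fun t ht => ?_, hBLhatv⟩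
  let w : smoothFunctions := ⟨v, hvsmooth⟩
  have hLhat_eq : Lhat v = ((smoothFunctions.reflection * aeval smoothFunctions.derivation Pt -
      aeval smoothFunctions.derivation (Qt.comp (-X))) w : smoothFunctions) := by
    ext t
    rw [hLhat, LinearMap.sub_apply, Submodule.coe_sub, Pi.sub_apply, Module.End.mul_apply,
      smoothFunctions.reflection_apply, smoothFunctions.aeval_derivation_apply,
      smoothFunctions.aeval_comp_neg_X_derivation_apply]
  have hL_eq (f : smoothFunctions) (t : ℝ) : L f t =
      ((aeval smoothFunctions.derivation Q +
        smoothFunctions.reflection * aeval smoothFunctions.derivation P) f :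
          smoothFunctions).1 t := by
    rw [hL, LinearMap.add_apply, Submodule.coe_add, Pi.add_apply, Module.End.mul_apply,
      smoothFunctions.reflection_apply, smoothFunctions.aeval_derivation_apply,
      smoothFunctions.aeval_derivation_apply]
  have hfactor := aeval_add_mul_aeval_sub_of_anticommute
    (A := Module.End ℝ smoothFunctions) smoothFunctions.derivation_mul_reflection
    smoothFunctions.reflection_mul_reflection Pt Qt hR
  rw [← hP, ← hQ, ← hS] at hfactor
  rw [hLhat_eq, hL_eq, ← hvS t ht, ← smoothFunctions.aeval_derivation_apply S w]
  exact congrFun (congrArg Subtype.val (LinearMap.congr_fun hfactor w)) t
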